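/- Let 𝔤 be a finite-dimensional semisimple Lie algebra over the field ℝ of real numbers satisfying the condition 𝒜(n), i.e. every abelian Lie subalgebra of 𝔤 has dimension at most n. Then dim 𝔤 ≤ 2n² + 15n. -/

import Mathlib

section EuclideanConfigurations

variable {V : Type*} [NormedAddCommGroup V] [InnerProductSpace ℝ V]

open Module Finset

/-- Selberg's generalization of Bessel's inequality, with a uniform bound. -/
lemma sum_inner_sq_le_of_sum_abs_inner_le {F : Finset V} {K : ℝ} (hK : 0 < K)
    (hF : ∀ f ∈ F, ∑ g ∈ F, |inner ℝ f g| ≤ K) (u : V) :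
    ∑ f ∈ F, inner ℝ f u ^ 2 ≤ K * inner ℝ u u := by
  set Q := ∑ f ∈ F, inner ℝ f u ^ 2 with hQ
  set w := ∑ f ∈ F, inner ℝ f u • f with hw
  have hwu : inner ℝ w u = Q := by
    rw [hw, hQ, sum_inner]
    refine Finset.sum_congr rfl fun f _ ↦ ?_
    rw [inner_smul_left, conj_trivial, sq]
  have hww : inner ℝ w w ≤ K * Q := by
    calc inner ℝ w w = ∑ f ∈ F, ∑ g ∈ F, inner ℝ f u * inner ℝ g u * inner ℝ f g := by
          rw [hw, sum_inner]
          refine sum_congr rfl fun f _ ↦ ?_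
          rw [inner_smul_left, inner_sum, mul_sum]
          refine sum_congr rfl fun g _ ↦ ?_
          rw [inner_smul_right, conj_trivial]; ring
      _ ≤ ∑ f ∈ F, ∑ g ∈ F,
            (inner ℝ f u ^ 2 * |inner ℝ f g| / 2 + inner ℝ g u ^ 2 * |inner ℝ f g| / 2) := by
          refine sum_le_sum fun f _ ↦ sum_le_sum fun g _ ↦ ?_
          have h1 : inner ℝ f u * inner ℝ g u * inner ℝ f g
              ≤ |inner ℝ f u * inner ℝ g u| * |inner ℝ f g| := by
            rw [← abs_mul]; exact le_abs_self _
          have h2 : |inner ℝ f u * inner ℝ g u| ≤ (inner ℝ f u ^ 2 + inner ℝ g u ^ 2) / 2 := by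
            rw [abs_le]
            constructor <;>
              nlinarith [sq_nonneg (inner ℝ f u + inner ℝ g u),
                sq_nonneg (inner ℝ f u - inner ℝ g u)]
          nlinarith [mul_le_mul_of_nonneg_right h2 (abs_nonneg (inner ℝ f g))]
      _ = ∑ f ∈ F, inner ℝ f u ^ 2 * ∑ g ∈ F, |inner ℝ f g| := by
          simp only [sum_add_distrib]
          rw [sum_comm (f := fun f g ↦ inner ℝ g u ^ 2 * |inner ℝ f g| / 2), ← sum_add_distrib]
          refine sum_congr rfl fun f _ ↦ ?_
          rw [← sum_add_distrib, mul_sum]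
          refine sum_congr rfl fun g _ ↦ ?_
          rw [real_inner_comm f g]; ring
      _ ≤ ∑ f ∈ F, inner ℝ f u ^ 2 * K :=
          sum_le_sum fun f hf ↦ mul_le_mul_of_nonneg_left (hF f hf) (sq_nonneg _)
      _ = K * Q := by rw [← sum_mul, mul_comm]
  have h0 : 0 ≤ inner ℝ (w - K • u) (w - K • u) := real_inner_self_nonneg
  simp only [inner_sub_left, inner_sub_right, inner_smul_left, inner_smul_right, conj_trivial,
    real_inner_comm w u, hwu] at h0
  have : K * Q ≤ K * (K * inner ℝ u u) := by linarith
  exact le_of_mul_le_mul_left this hK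

/-- A finite set of vectors of square norm `s`, any two distinct ones of which are orthogonal or
opposite. -/
structure IsOrthoplex (F : Finset V) (s : ℝ) : Prop where
  pos : 0 < s
  inner_self : ∀ f ∈ F, inner ℝ f f = s
  inner_of_ne : ∀ f ∈ F, ∀ g ∈ F, f ≠ g → inner ℝ f g = 0 ∨ inner ℝ f g = -s

lemma eq_neg_of_inner_eq_neg {f g : V} {s : ℝ} (hf : inner ℝ f f = s) (hg : inner ℝ g g = s)
    (h : inner ℝ f g = -s) : g = -f := by
  rw [eq_neg_iff_add_eq_zero, ← inner_self_eq_zero (𝕜 := ℝ)]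
  simp only [inner_add_left, inner_add_right, hf, hg, h, real_inner_comm f g]
  ring

lemma eq_of_inner_eq {f g : V} {s : ℝ} (hf : inner ℝ f f = s) (hg : inner ℝ g g = s)
    (h : inner ℝ f g = s) : g = f := by
  rw [← sub_eq_zero, ← inner_self_eq_zero (𝕜 := ℝ)]
  simp only [inner_sub_left, inner_sub_right, hf, hg, h, real_inner_comm f g]
  ring

namespace IsOrthoplex

variable {F : Finset V} {s : ℝ}

lemma sum_inner_sq_le (hF : IsOrthoplex F s) (u : V) :
    ∑ f ∈ F, inner ℝ f u ^ 2 ≤ 2 * s * inner ℝ u u := by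
  classical
  have hs := hF.pos
  refine sum_inner_sq_le_of_sum_abs_inner_le (by positivity) (fun f hf ↦ ?_) u
  calc ∑ g ∈ F, |inner ℝ f g|
      ≤ ∑ g ∈ F, ((if g = f then s else 0) + (if g = -f then s else 0)) := by
        refine sum_le_sum fun g hg ↦ ?_
        have h1 : 0 ≤ (if g = f then s else 0) := by split_ifs <;> linarith
        have h2 : 0 ≤ (if g = -f then s else 0) := by split_ifs <;> linarith
        by_cases hgf : g = f
        · subst hgf
          rw [hF.inner_self g hg, abs_of_pos hs, if_pos rfl]
          linarith
        · rcases hF.inner_of_ne f hf g hg (Ne.symm hgf) with h | h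
          · rw [h, abs_zero]; linarith
          · rw [h, abs_neg, abs_of_pos hs,
              if_pos (eq_neg_of_inner_eq_neg (hF.inner_self f hf) (hF.inner_self g hg) h)]
            linarith
    _ ≤ 2 * s := by
        rw [sum_add_distrib, sum_ite_eq', sum_ite_eq']
        split_ifs <;> linarith

lemma card_add_le [FiniteDimensional ℝ V] (hF : IsOrthoplex F s) {k : ℕ} {h : Fin k → V}
    (hh : Orthonormal ℝ h) (hFh : ∀ f ∈ F, ∀ i, inner ℝ f (h i) = 0) :
    #F + 2 * k ≤ 2 * finrank ℝ V := by
  have hs := hF.pos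
  set e := stdOrthonormalBasis ℝ V
  have key (a : Fin (finrank ℝ V)) :
      ∑ f ∈ F, inner ℝ f (e a) ^ 2 ≤ 2 * s * (1 - ∑ i, inner ℝ (h i) (e a) ^ 2) := by
    have := hF.sum_inner_sq_le (e a - ∑ i, inner ℝ (h i) (e a) • h i)
    have h1 : inner ℝ (e a - ∑ i, inner ℝ (h i) (e a) • h i)
        (e a - ∑ i, inner ℝ (h i) (e a) • h i) = 1 - ∑ i, inner ℝ (h i) (e a) ^ 2 := by
      have h2 : inner ℝ (∑ i, inner ℝ (h i) (e a) • h i) (∑ i, inner ℝ (h i) (e a) • h i)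
          = ∑ i, inner ℝ (h i) (e a) ^ 2 := by
        rw [hh.inner_sum]; simp [sq]
      have h3 : inner ℝ (∑ i, inner ℝ (h i) (e a) • h i) (e a)
          = ∑ i, inner ℝ (h i) (e a) ^ 2 := by
        rw [sum_inner]; simp [inner_smul_left, sq]
      have h4 : inner ℝ (e a) (e a) = 1 := by simp
      rw [inner_sub_left, inner_sub_right, inner_sub_right, h2, h3, h4, real_inner_comm _ (e a), h3]
      ring
    rw [h1] at this
    refine le_trans (le_of_eq (sum_congr rfl fun f hf ↦ ?_)) this
    rw [inner_sub_right, inner_sum]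
    simp [inner_smul_right, hFh f hf]
  have hsum := sum_le_sum fun a (_ : a ∈ univ) ↦ key a
  rw [sum_comm (t := F), ← mul_sum, sum_sub_distrib, sum_comm (s := univ) (t := univ)] at hsum
  have hsq (x : V) : ∑ a, inner ℝ x (e a) ^ 2 = inner ℝ x x := by
    rw [← e.sum_inner_mul_inner x x]
    exact sum_congr rfl fun a _ ↦ by rw [sq, real_inner_comm x (e a)]
  rw [sum_congr rfl fun x (_ : x ∈ F) ↦ hsq x, sum_congr rfl fun i (_ : i ∈ univ) ↦ hsq (h i),
    sum_congr rfl hF.inner_self, sum_congr rfl fun i _ ↦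
    show inner ℝ (h i) (h i) = (1 : ℝ) by simp [hh.1 i]] at hsum
  simp only [sum_const, card_univ, Fintype.card_fin, nsmul_eq_mul, mul_one] at hsum
  have : ((#F : ℝ) + 2 * k) ≤ 2 * finrank ℝ V := by
    have : s * ((#F : ℝ) + 2 * k) ≤ s * (2 * finrank ℝ V) := by linarith
    exact le_of_mul_le_mul_left this hs
  exact_mod_cast this

end IsOrthoplex

/-- A finite set of vectors of square norm `3` spanning equiangular lines with angle
`arccos (1 / 3)`. -/
structure IsEquiangularThree (X : Finset V) : Prop where
  inner_self : ∀ x ∈ X, inner ℝ x x = (3 : ℝ)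
  inner_of_ne : ∀ x ∈ X, ∀ y ∈ X, x ≠ y →
    inner ℝ x y = (1 : ℝ) ∨ inner ℝ x y = (-1 : ℝ) ∨ inner ℝ x y = (-3 : ℝ)

namespace IsEquiangularThree

variable {X : Finset V}

lemma isOrthoplex_image_sub [DecidableEq V] (hX : IsEquiangularThree X) {C : Finset V}
    (hC : C ⊆ X) {q : V} (hq : inner ℝ q q = (1 : ℝ)) (hCq : ∀ u ∈ C, inner ℝ u q = (1 : ℝ)) :
    IsOrthoplex (C.image (· - q)) 2 where
  pos := two_pos
  inner_self := by
    intro f hf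
    obtain ⟨u, hu, rfl⟩ := mem_image.mp hf
    simp only [inner_sub_left, inner_sub_right, hX.inner_self u (hC hu), hCq u hu, hq,
      real_inner_comm u q]
    norm_num
  inner_of_ne := by
    intro f hf g hg hfg
    obtain ⟨u, hu, rfl⟩ := mem_image.mp hf
    obtain ⟨v, hv, rfl⟩ := mem_image.mp hg
    have huv : u ≠ v := fun h ↦ hfg (by rw [h])
    have hqv : inner ℝ q v = (1 : ℝ) := by rw [real_inner_comm, hCq v hv]
    simp only [inner_sub_left, inner_sub_right, hCq u hu, hq, hqv]
    rcases hX.inner_of_ne u (hC hu) v (hC hv) huv with h | h | h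
    · left; rw [h]; norm_num
    · right; rw [h]; norm_num
    · have h1 := eq_neg_of_inner_eq_neg (hX.inner_self u (hC hu)) (hX.inner_self v (hC hv)) h
      have h2 := hCq v hv
      rw [h1, inner_neg_left, hCq u hu] at h2
      norm_num at h2

lemma sum_inner_sub_sq_le (hX : IsEquiangularThree X) {C : Finset V}
    (hC : C ⊆ X) {q : V} (hq : inner ℝ q q = (1 : ℝ)) (hCq : ∀ u ∈ C, inner ℝ u q = (1 : ℝ))
    (v : V) : ∑ u ∈ C, inner ℝ (u - q) v ^ 2 ≤ 4 * inner ℝ v v := by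
  classical
  have := (hX.isOrthoplex_image_sub hC hq hCq).sum_inner_sq_le v
  rw [sum_image fun _ _ _ _ h ↦ sub_left_injective h] at this
  linarith

lemma card_add_le [FiniteDimensional ℝ V] (hX : IsEquiangularThree X) {C : Finset V}
    (hC : C ⊆ X) {q : V} (hq : inner ℝ q q = (1 : ℝ)) (hCq : ∀ u ∈ C, inner ℝ u q = (1 : ℝ))
    {k : ℕ} {h : Fin k → V} (hh : Orthonormal ℝ h)
    (hCh : ∀ u ∈ C, ∀ i, inner ℝ u (h i) = inner ℝ q (h i)) :
    #C + 2 * k ≤ 2 * finrank ℝ V := by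
  classical
  have := (hX.isOrthoplex_image_sub hC hq hCq).card_add_le hh (by
    intro f hf i
    obtain ⟨u, hu, rfl⟩ := mem_image.mp hf
    rw [inner_sub_left, hCh u hu, sub_self])
  rwa [card_image_of_injective _ sub_left_injective] at this

lemma inner_eq (hX : IsEquiangularThree X) {x y : V} (hx : x ∈ X) (hy : y ∈ X) :
    x = y ∨ y = -x ∨ inner ℝ x y = (1 : ℝ) ∨ inner ℝ x y = (-1 : ℝ) := by
  by_cases h : x = y
  · exact Or.inl h
  · rcases hX.inner_of_ne x hx y hy h with h | h | h
    · tauto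
    · tauto
    · exact Or.inr <| Or.inl <|
        eq_neg_of_inner_eq_neg (hX.inner_self x hx) (hX.inner_self y hy) h

lemma one_le_inner_sq (hX : IsEquiangularThree X) {x y : V} (hx : x ∈ X) (hy : y ∈ X) :
    1 ≤ inner ℝ x y ^ 2 := by
  by_cases h : x = y
  · rw [h, hX.inner_self y hy]; norm_num
  · rcases hX.inner_of_ne x hx y hy h with h | h | h <;> rw [h] <;> norm_num

/-- The vectors of `X` whose projection to the span of `h` is `ε • h k`. -/
noncomputable def pillar (X : Finset V) (h : Fin 3 → V) (k : Fin 3) (ε : ℝ) : Finset V := by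
  classical
  exact X.filter fun u ↦ ∀ j, inner ℝ u (h j) = inner ℝ (ε • h k) (h j)

variable {h : Fin 3 → V}

lemma mem_pillar {k : Fin 3} {ε : ℝ} {u : V} : u ∈ pillar X h k ε ↔
    u ∈ X ∧ ∀ j, inner ℝ u (h j) = inner ℝ (ε • h k) (h j) := by
  simp [pillar]

lemma pillar_subset (k : Fin 3) (ε : ℝ) : pillar X h k ε ⊆ X :=
  fun _ hu ↦ (mem_pillar.mp hu).1

lemma inner_smul_self_of_orthonormal (hh : Orthonormal ℝ h) (k : Fin 3) {ε : ℝ}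
    (hε : ε * ε = 1) : inner ℝ (ε • h k) (ε • h k) = (1 : ℝ) := by
  rw [inner_smul_left, inner_smul_right, real_inner_self_eq_norm_sq, hh.1 k]
  simpa using hε

lemma inner_of_mem_pillar (hh : Orthonormal ℝ h) {k : Fin 3} {ε : ℝ} (hε : ε * ε = 1) {u : V}
    (hu : u ∈ pillar X h k ε) : inner ℝ u (ε • h k) = (1 : ℝ) := by
  rw [inner_smul_right, (mem_pillar.mp hu).2, ← inner_smul_right,
    inner_smul_self_of_orthonormal hh k hε]

lemma inner_of_mem_pillar_of_ne (hh : Orthonormal ℝ h) {k l : Fin 3} (hkl : k ≠ l) {ε δ : ℝ}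
    {u : V} (hu : u ∈ pillar X h k ε) : inner ℝ u (δ • h l) = (0 : ℝ) := by
  rw [inner_smul_right, (mem_pillar.mp hu).2, inner_smul_left, hh.2 hkl]
  simp

lemma card_pillar_add_le [FiniteDimensional ℝ V] (hX : IsEquiangularThree X)
    (hh : Orthonormal ℝ h) (k : Fin 3) {ε : ℝ} (hε : ε * ε = 1) :
    #(pillar X h k ε) + 6 ≤ 2 * finrank ℝ V :=
  hX.card_add_le (pillar_subset k ε) (inner_smul_self_of_orthonormal hh k hε)
    (fun _ hu ↦ inner_of_mem_pillar hh hε hu) hh (fun _ hu ↦ (mem_pillar.mp hu).2)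

lemma card_pillar_le_of_nonempty (hX : IsEquiangularThree X)
    (hh : Orthonormal ℝ h) {k l : Fin 3} (hkl : k ≠ l) {ε δ : ℝ} (hε : ε * ε = 1)
    (hδ : δ * δ = 1) (hne : (pillar X h l δ).Nonempty) : #(pillar X h k ε) ≤ 8 := by
  obtain ⟨v, hv⟩ := hne
  have h1 := hX.sum_inner_sub_sq_le (pillar_subset k ε) (inner_smul_self_of_orthonormal hh k hε)
    (fun _ hu ↦ inner_of_mem_pillar hh hε hu) (v - δ • h l)
  have h2 : inner ℝ (v - δ • h l) (v - δ • h l) = (2 : ℝ) := by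
    rw [inner_sub_left, inner_sub_right, inner_sub_right, real_inner_comm v (δ • h l),
      hX.inner_self v (pillar_subset _ _ hv), inner_of_mem_pillar hh hδ hv,
      inner_smul_self_of_orthonormal hh l hδ]
    norm_num
  have h3 : (#(pillar X h k ε) : ℝ) ≤
      ∑ u ∈ pillar X h k ε, inner ℝ (u - ε • h k) (v - δ • h l) ^ 2 := by
    rw [← nsmul_one, ← sum_const]
    refine sum_le_sum fun u hu ↦ ?_
    have h4 : inner ℝ (ε • h k) (δ • h l) = (0 : ℝ) := by
      simp [inner_smul_left, inner_smul_right, hh.2 hkl]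
    rw [inner_sub_left, inner_sub_right, inner_sub_right, inner_of_mem_pillar_of_ne hh hkl hu,
      real_inner_comm v (ε • h k), inner_of_mem_pillar_of_ne hh hkl.symm hv, h4]
    simpa using hX.one_le_inner_sq (pillar_subset _ _ hu) (pillar_subset _ _ hv)
  rw [h2] at h1
  have : (#(pillar X h k ε) : ℝ) ≤ 8 := by linarith
  exact_mod_cast this

/-- Lemmens and Seidel: the case of equiangular lines containing a base of size three. -/
lemma card_le_of_exists_triple [FiniteDimensional ℝ V] (hX : IsEquiangularThree X) {x y z : V}
    (hx : x ∈ X) (hy : y ∈ X) (hz : z ∈ X) (hxy : inner ℝ x y = (-1 : ℝ))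
    (hxz : inner ℝ x z = (-1 : ℝ)) (hyz : inner ℝ y z = (-1 : ℝ)) :
    #X ≤ 4 * finrank ℝ V + 28 := by
  classical
  have hxx := hX.inner_self x hx
  have hyy := hX.inner_self y hy
  have hzz := hX.inner_self z hz
  have hyx : inner ℝ y x = (-1 : ℝ) := by rw [real_inner_comm, hxy]
  have hzx : inner ℝ z x = (-1 : ℝ) := by rw [real_inner_comm, hxz]
  have hzy : inner ℝ z y = (-1 : ℝ) := by rw [real_inner_comm, hyz]
  set h : Fin 3 → V := ![(1 / 2 : ℝ) • (x + y), (1 / 2 : ℝ) • (x + z), (1 / 2 : ℝ) • (y + z)]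
    with h_def
  have hh : Orthonormal ℝ h := by
    rw [orthonormal_iff_ite]
    intro i j
    fin_cases i <;> fin_cases j <;>
      simp [h_def, inner_smul_left, inner_smul_right, inner_add_left, inner_add_right, hxx, hyy,
        hzz, hxy, hxz, hyz, hyx, hzx, hzy, -inner_self_eq_norm_sq_to_K] <;> norm_num
  set w := -(x + y + z) with w_def
  have hww : inner ℝ w w = (3 : ℝ) := by
    simp only [w_def, inner_neg_left, inner_neg_right, inner_add_left, inner_add_right, hxx, hyy,
        hzz, hxy, hxz, hyz, hyx, hzx, hzy]
    norm_num
  set T : Finset V := {x, y, z, w}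
  have hT : #T ≤ 4 := card_le_four
  have hcover : X ⊆ (T ∪ T.image (- ·)) ∪ ((pillar X h 0 1 ∪ pillar X h 0 (-1)) ∪
      (pillar X h 1 1 ∪ pillar X h 1 (-1)) ∪ (pillar X h 2 1 ∪ pillar X h 2 (-1))) := by
    intro u hu
    by_contra hcon
    simp only [mem_union, not_or] at hcon
    obtain ⟨⟨hT1, hT2⟩, ⟨⟨h1, h2⟩, h3, h4⟩, h5, h6⟩ := hcon
    have hTne (t : V) (ht : t ∈ T) : u ≠ t ∧ u ≠ -t :=
      ⟨fun h ↦ hT1 (h ▸ ht), fun h ↦ hT2 (h ▸ mem_image_of_mem _ ht)⟩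
    have hval (t : V) (ht : t ∈ T) (htX : t ∈ X) :
        inner ℝ u t = (1 : ℝ) ∨ inner ℝ u t = (-1 : ℝ) := by
      rcases hX.inner_eq hu htX with h | h | h
      · exact absurd h (hTne t ht).1
      · exact absurd (by rw [h, neg_neg]) (hTne t ht).2
      · exact h
    have huu := hX.inner_self u hu
    have huw : inner ℝ u w = -(inner ℝ u x + inner ℝ u y + inner ℝ u z) := by
      simp only [w_def, inner_neg_right, inner_add_right]
    have hw3 : inner ℝ u w ≠ 3 := fun h ↦
      (hTne w (by simp [T])).1 (eq_of_inner_eq huu hww h).symm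
    have hw3' : inner ℝ u w ≠ -3 := fun h ↦
      (hTne w (by simp [T])).2 (by rw [eq_neg_of_inner_eq_neg huu hww h, neg_neg])
    have hu0 : inner ℝ u (h 0) = (inner ℝ u x + inner ℝ u y) / 2 := by
      simp only [h_def, Matrix.cons_val, inner_smul_right, inner_add_right]; ring
    have hu1 : inner ℝ u (h 1) = (inner ℝ u x + inner ℝ u z) / 2 := by
      simp only [h_def, Matrix.cons_val, inner_smul_right, inner_add_right]; ring
    have hu2 : inner ℝ u (h 2) = (inner ℝ u y + inner ℝ u z) / 2 := by
      simp only [h_def, Matrix.cons_val, inner_smul_right, inner_add_right]; ring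
    have hpillar (k : Fin 3) (ε : ℝ) : u ∈ pillar X h k ε ↔
        inner ℝ u (h 0) = ε * (if k = 0 then 1 else 0) ∧
        inner ℝ u (h 1) = ε * (if k = 1 then 1 else 0) ∧
        inner ℝ u (h 2) = ε * (if k = 2 then 1 else 0) := by
      simp [mem_pillar, hu, Fin.forall_fin_succ, inner_smul_left, orthonormal_iff_ite.mp hh]
    rw [huw] at hw3 hw3'
    rcases hval x (by simp [T]) hx with a | a <;> rcases hval y (by simp [T]) hy with b | b <;>
      rcases hval z (by simp [T]) hz with c | c <;> rw [a, b] at hu0 <;> rw [a, c] at hu1 <;>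
      rw [b, c] at hu2 <;> rw [a, b, c] at hw3 hw3' <;>
      (rw [hpillar, hu0, hu1, hu2] at h1 h2 h3 h4 h5 h6
       revert h1 h2 h3 h4 h5 h6 hw3 hw3'
       norm_num [Fin.ext_iff])
  have hcard := (card_le_card hcover).trans <| (card_union_le _ _).trans <| Nat.add_le_add
    (card_union_le _ _) <| (card_union_le _ _).trans <| Nat.add_le_add
      ((card_union_le _ _).trans <| Nat.add_le_add (card_union_le _ _) (card_union_le _ _))
      (card_union_le _ _)
  have himg : #(T.image (- ·)) ≤ #T := card_image_le
  have h1 : (1 : ℝ) * 1 = 1 := by norm_num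
  have h2 : (-1 : ℝ) * -1 = 1 := by norm_num
  have hbound (k : Fin 3) :
      #(pillar X h k 1) + #(pillar X h k (-1)) + 12 ≤ 4 * finrank ℝ V := by
    have := hX.card_pillar_add_le hh k h1
    have := hX.card_pillar_add_le hh k h2
    omega
  have hcross (k l : Fin 3) (hkl : k ≠ l) :
      #(pillar X h l 1) + #(pillar X h l (-1)) = 0 ∨
      #(pillar X h k 1) + #(pillar X h k (-1)) ≤ 16 := by
    rcases (pillar X h l 1).eq_empty_or_nonempty with e1 | e1
    · rcases (pillar X h l (-1)).eq_empty_or_nonempty with e2 | e2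
      · simp [e1, e2]
      · have := hX.card_pillar_le_of_nonempty hh hkl h1 h2 e2
        have := hX.card_pillar_le_of_nonempty hh hkl h2 h2 e2
        omega
    · have := hX.card_pillar_le_of_nonempty hh hkl h1 h1 e1
      have := hX.card_pillar_le_of_nonempty hh hkl h2 h1 e1
      omega
  have := hbound 0
  have := hbound 1
  have := hbound 2
  have := hcross 0 1 (by decide)
  have := hcross 0 2 (by decide)
  have := hcross 1 0 (by decide)
  have := hcross 1 2 (by decide)
  have := hcross 2 0 (by decide)
  have := hcross 2 1 (by decide)
  omega

lemma card_le_of_forall_not_triple [FiniteDimensional ℝ V] (hX : IsEquiangularThree X)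
    (hneg : ∀ x ∈ X, -x ∈ X)
    (hno : ∀ x ∈ X, ∀ y ∈ X, ∀ z ∈ X, inner ℝ x y = (-1 : ℝ) → inner ℝ x z = (-1 : ℝ) →
      inner ℝ y z ≠ (-1 : ℝ)) :
    #X ≤ 2 * finrank ℝ V + 2 := by
  classical
  rcases X.eq_empty_or_nonempty with rfl | ⟨x, hx⟩
  · simp
  set Y := X.filter fun u ↦ inner ℝ x u = (1 : ℝ) with hY
  have hYX : Y ⊆ X := filter_subset _ _
  have hYY (u : V) (hu : u ∈ Y) (v : V) (hv : v ∈ Y) (huv : u ≠ v) : inner ℝ u v = (1 : ℝ) := by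
    rw [hY, mem_filter] at hu hv
    rcases hX.inner_eq hu.1 hv.1 with h | h | h | h
    · exact absurd h huv
    · have := hv.2
      rw [h, inner_neg_right, hu.2] at this
      norm_num at this
    · exact h
    · exact absurd h (hno (-x) (hneg x hx) u hu.1 v hv.1 (by rw [inner_neg_left, hu.2])
        (by rw [inner_neg_left, hv.2]))
  have hcover : X ⊆ {x, -x} ∪ (Y ∪ Y.image (- ·)) := by
    intro u hu
    simp only [mem_union, mem_insert, mem_singleton]
    rcases hX.inner_eq hx hu with h | h | h | h
    · tauto
    · tauto
    · exact Or.inr <| Or.inl <| mem_filter.mpr ⟨hu, h⟩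
    · exact Or.inr <| Or.inr <| mem_image.mpr
        ⟨-u, mem_filter.mpr ⟨hneg u hu, by rw [inner_neg_right, h]; norm_num⟩, neg_neg u⟩
  have hlin : LinearIndependent ℝ (fun u : Y ↦ (u : V)) := by
    rw [Fintype.linearIndependent_iff]
    intro g hg u
    have hu (v : Y) : 2 * g v + ∑ w, g w = 0 := by
      have h1 : inner ℝ (v : V) (∑ w : Y, g w • (w : V)) = (0 : ℝ) := by rw [hg, inner_zero_right]
      rw [inner_sum] at h1
      rw [← h1, ← add_sum_erase univ g (mem_univ v),
        ← add_sum_erase univ (fun w : Y ↦ inner ℝ (v : V) (g w • (w : V))) (mem_univ v),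
        inner_smul_right, hX.inner_self v (hYX v.2)]
      have h2 : ∑ w ∈ univ.erase v, inner ℝ (v : V) (g w • (w : V)) = ∑ w ∈ univ.erase v, g w :=
        sum_congr rfl fun w hw ↦ by
          rw [inner_smul_right, hYY v v.2 w w.2 (fun h ↦ (ne_of_mem_erase hw)
            (Subtype.ext h.symm)), mul_one]
      rw [h2]; ring
    have hs := sum_eq_zero (s := univ) fun v _ ↦ hu v
    rw [sum_add_distrib, ← mul_sum, sum_const, nsmul_eq_mul, ← add_mul] at hs
    have hs0 : ∑ w, g w = 0 := by
      rcases mul_eq_zero.mp hs with h | h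
      · have : (0 : ℝ) < 2 + (#(univ : Finset Y) : ℝ) := by positivity
        linarith
      · exact h
    have := hu u
    linarith
  have h1 := hlin.fintype_card_le_finrank
  rw [Fintype.card_coe] at h1
  have h2 := (card_le_card hcover).trans <| (card_union_le _ _).trans <| Nat.add_le_add
    card_le_two (card_union_le _ _)
  have h3 : #(Y.image (- ·)) ≤ #Y := card_image_le
  omega

theorem card_le [FiniteDimensional ℝ V] (hX : IsEquiangularThree X) :
    #X ≤ 4 * finrank ℝ V + 28 := by
  classical
  set Z := X ∪ X.image (- ·) with hZ
  have mem_Z {u : V} (hu : u ∈ Z) : ∃ x ∈ X, u = x ∨ u = -x := by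
    rw [hZ, mem_union, mem_image] at hu
    rcases hu with hu | ⟨x, hx, rfl⟩
    · exact ⟨u, hu, Or.inl rfl⟩
    · exact ⟨x, hx, Or.inr rfl⟩
  have hZe : IsEquiangularThree Z := by
    constructor
    · intro u hu
      obtain ⟨x, hx, hux | hux⟩ := mem_Z hu <;> rw [hux]
      · exact hX.inner_self x hx
      · rw [inner_neg_neg, hX.inner_self x hx]
    · intro u hu v hv huv
      obtain ⟨x, hx, hux⟩ := mem_Z hu
      obtain ⟨y, hy, hvy⟩ := mem_Z hv
      have hxx := hX.inner_self x hx
      rcases hX.inner_eq hx hy with h | h | h | h <;> rcases hux with rfl | rfl <;>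
        rcases hvy with rfl | rfl <;>
        simp_all only [inner_neg_left, inner_neg_right, neg_neg, ne_eq, not_true_eq_false] <;>
        norm_num
  have hneg (u : V) (hu : u ∈ Z) : -u ∈ Z := by
    obtain ⟨x, hx, rfl | rfl⟩ := mem_Z hu
    · exact mem_union_right _ (mem_image_of_mem _ hx)
    · rw [neg_neg]; exact mem_union_left _ hx
  have hXZ : #X ≤ #Z := card_le_card subset_union_left
  by_cases hT : ∃ x ∈ Z, ∃ y ∈ Z, ∃ z ∈ Z, inner ℝ x y = (-1 : ℝ) ∧ inner ℝ x z = (-1 : ℝ) ∧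
      inner ℝ y z = (-1 : ℝ)
  · obtain ⟨x, hx, y, hy, z, hz, hxy, hxz, hyz⟩ := hT
    exact hXZ.trans (hZe.card_le_of_exists_triple hx hy hz hxy hxz hyz)
  · have := hZe.card_le_of_forall_not_triple hneg (by
      intro x hx y hy z hz hxy hxz hyz
      exact hT ⟨x, hx, y, hy, z, hz, hxy, hxz, hyz⟩)
    omega

end IsEquiangularThree

lemma inner_sq_le_inner_mul_inner (x y : V) : inner ℝ x y ^ 2 ≤ inner ℝ x x * inner ℝ y y := by
  rw [sq]; exact real_inner_mul_inner_self_le x y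

/-- The equality case of the Cauchy-Schwarz inequality. -/
lemma eq_smul_of_inner_sq_eq {x y : V} (hy : inner ℝ y y ≠ (0 : ℝ))
    (h : inner ℝ x y ^ 2 = inner ℝ x x * inner ℝ y y) :
    x = (inner ℝ x y / inner ℝ y y) • y := by
  rw [← sub_eq_zero, ← inner_self_eq_zero (𝕜 := ℝ)]
  simp only [inner_sub_left, inner_sub_right, inner_smul_left, inner_smul_right, conj_trivial,
    real_inner_comm x y]
  field_simp
  rw [mul_comm (inner ℝ y y), ← h]
  ring

/-- Three sets of vectors of square norms `3`, `1` and `1 / 3`: these arise from the roots which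
make an angle of `π / 3`, `π / 4` and `π / 6` with a fixed long root, by projection to the
hyperplane orthogonal to it. -/
structure IsRootProjection (X₁ X₂ X₃ : Finset V) : Prop where
  self₁ : ∀ x ∈ X₁, inner ℝ x x = (3 : ℝ)
  self₂ : ∀ x ∈ X₂, inner ℝ x x = (1 : ℝ)
  self₃ : ∀ x ∈ X₃, inner ℝ x x = (1 / 3 : ℝ)
  inner₁₁ : ∀ x ∈ X₁, ∀ y ∈ X₁, ∃ k : ℤ, inner ℝ x y = (2 * k - 1 : ℝ)
  inner₁₂ : ∀ x ∈ X₁, ∀ y ∈ X₂, ∃ k : ℤ, inner ℝ x y = (2 * k - 1 : ℝ)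
  inner₁₃ : ∀ x ∈ X₁, ∀ y ∈ X₃, ∃ k : ℤ, inner ℝ x y = (2 * k - 1 : ℝ)
  inner₂₂ : ∀ x ∈ X₂, ∀ y ∈ X₂, ∃ k : ℤ, inner ℝ x y = (k - 1 : ℝ)
  inner₂₃ : ∀ x ∈ X₂, ∀ y ∈ X₃, ∃ k : ℤ, inner ℝ x y = (2 * k - 1 : ℝ)
  inner₃₃ : ∀ x ∈ X₃, ∀ y ∈ X₃, ∃ k : ℤ, inner ℝ x y = (2 / 3 * k - 1 : ℝ)

namespace IsRootProjection

variable {X₁ X₂ X₃ : Finset V}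

lemma isEquiangularThree (h : IsRootProjection X₁ X₂ X₃) : IsEquiangularThree X₁ where
  inner_self := h.self₁
  inner_of_ne := by
    intro x hx y hy hxy
    obtain ⟨k, hk⟩ := h.inner₁₁ x hx y hy
    have hcs := inner_sq_le_inner_mul_inner x y
    rw [h.self₁ x hx, h.self₁ y hy, hk] at hcs
    have h1 : (2 * k - 1) ^ 2 ≤ 3 * 3 := by exact_mod_cast hcs
    have h2 : k ≤ 2 := by nlinarith
    have h3 : -1 ≤ k := by nlinarith
    rw [hk]
    interval_cases k
    · norm_num
    · norm_num
    · norm_num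
    · exfalso
      norm_num at hk
      exact hxy (eq_of_inner_eq (h.self₁ x hx) (h.self₁ y hy) hk).symm

lemma isOrthoplex (h : IsRootProjection X₁ X₂ X₃) : IsOrthoplex X₂ 1 where
  pos := one_pos
  inner_self := h.self₂
  inner_of_ne := by
    intro x hx y hy hxy
    obtain ⟨k, hk⟩ := h.inner₂₂ x hx y hy
    have hcs := inner_sq_le_inner_mul_inner x y
    rw [h.self₂ x hx, h.self₂ y hy, hk] at hcs
    have h1 : (k - 1) ^ 2 ≤ 1 * 1 := by exact_mod_cast hcs
    have h2 : k ≤ 2 := by nlinarith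
    have h3 : 0 ≤ k := by nlinarith
    rw [hk]
    interval_cases k
    · norm_num
    · norm_num
    · exfalso
      norm_num at hk
      exact hxy (eq_of_inner_eq (h.self₂ x hx) (h.self₂ y hy) hk).symm

lemma inner_eq_one_or (h : IsRootProjection X₁ X₂ X₃) {x y : V} (hx : x ∈ X₁) (hy : y ∈ X₂) :
    inner ℝ x y = (1 : ℝ) ∨ inner ℝ x y = (-1 : ℝ) := by
  obtain ⟨k, hk⟩ := h.inner₁₂ x hx y hy
  have hcs := inner_sq_le_inner_mul_inner x y
  rw [h.self₁ x hx, h.self₂ y hy, hk] at hcs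
  have h1 : (2 * k - 1) ^ 2 ≤ 3 * 1 := by exact_mod_cast hcs
  have h2 : k ≤ 1 := by nlinarith
  have h3 : 0 ≤ k := by nlinarith
  rw [hk]
  interval_cases k <;> norm_num

lemma weight_le_of_nonempty_right (h : IsRootProjection X₁ X₂ X₃) (hne : X₃.Nonempty) :
    #X₁ + 2 * #X₂ + 3 * #X₃ ≤ 8 := by
  classical
  obtain ⟨y, hy⟩ := hne
  have hyy := h.self₃ y hy
  have h2 : X₂ = ∅ := by
    rw [eq_empty_iff_forall_notMem]
    intro x hx
    obtain ⟨k, hk⟩ := h.inner₂₃ x hx y hy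
    have hcs := inner_sq_le_inner_mul_inner x y
    rw [h.self₂ x hx, hyy, hk] at hcs
    have h1 : (2 * (k : ℝ) - 1) ^ 2 < 1 := by linarith
    have h1 : (2 * k - 1) ^ 2 < 1 := by exact_mod_cast h1
    have h2 : k < 1 := by nlinarith
    have h3 : 0 < k := by nlinarith
    omega
  have h1 : X₁ ⊆ {(3 : ℝ) • y, (-3 : ℝ) • y} := by
    intro x hx
    obtain ⟨k, hk⟩ := h.inner₁₃ x hx y hy
    have hcs := inner_sq_le_inner_mul_inner x y
    have hxx := h.self₁ x hx
    rw [hxx, hyy, hk] at hcs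
    have h1 : (2 * (k : ℝ) - 1) ^ 2 ≤ 1 := by linarith
    have h1 : (2 * k - 1) ^ 2 ≤ 1 := by exact_mod_cast h1
    have h2 : k ≤ 1 := by nlinarith
    have h3 : 0 ≤ k := by nlinarith
    have := eq_smul_of_inner_sq_eq (x := x) (y := y) (by rw [hyy]; norm_num)
      (by rw [hk, hxx, hyy]; interval_cases k <;> norm_num)
    rw [hk, hyy] at this
    rw [mem_insert, mem_singleton, this]
    interval_cases k <;> norm_num
  have h3 : X₃ ⊆ {(1 : ℝ) • y, (-1 : ℝ) • y} := by
    intro x hx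
    obtain ⟨k, hk⟩ := h.inner₃₃ x hx y hy
    have hcs := inner_sq_le_inner_mul_inner x y
    have hxx := h.self₃ x hx
    rw [hxx, hyy, hk] at hcs
    have h1 : (2 * (k : ℝ) - 3) ^ 2 ≤ 1 := by nlinarith
    have h1 : (2 * k - 3) ^ 2 ≤ 1 := by exact_mod_cast h1
    have h2 : k ≤ 2 := by nlinarith
    have h3 : 1 ≤ k := by nlinarith
    have := eq_smul_of_inner_sq_eq (x := x) (y := y) (by rw [hyy]; norm_num)
      (by rw [hk, hxx, hyy]; interval_cases k <;> norm_num)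
    rw [hk, hyy] at this
    rw [mem_insert, mem_singleton, this]
    interval_cases k <;> norm_num
  have h1' := (card_le_card h1).trans card_le_two
  have h3' := (card_le_card h3).trans card_le_two
  rw [h2, card_empty]
  omega

theorem weight_le [FiniteDimensional ℝ V] (h : IsRootProjection X₁ X₂ X₃) :
    #X₁ + 2 * #X₂ + 3 * #X₃ ≤ 4 * finrank ℝ V + 28 := by
  classical
  rcases X₃.eq_empty_or_nonempty with h3 | h3
  · rw [h3, card_empty]
    have hX := h.isEquiangularThree
    rcases X₂.eq_empty_or_nonempty with h2 | ⟨y, hy⟩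
    · rw [h2, card_empty]
      exact hX.card_le
    · rcases X₁.eq_empty_or_nonempty with h1 | ⟨x, hx⟩
      · have := h.isOrthoplex.card_add_le (k := 0) (h := Fin.elim0)
          ⟨fun i ↦ i.elim0, fun i ↦ i.elim0⟩ (fun _ _ i ↦ i.elim0)
        rw [h1, card_empty]
        omega
      · have hX2 : #X₂ ≤ 6 := by
          have := h.isOrthoplex.sum_inner_sq_le x
          rw [h.self₁ x hx, sum_congr rfl fun f hf ↦ show inner ℝ f x ^ 2 = (1 : ℝ) by
            rw [real_inner_comm]
            rcases h.inner_eq_one_or hx hf with h | h <;> rw [h] <;> norm_num] at this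
          rw [sum_const, nsmul_one] at this
          have : (#X₂ : ℝ) ≤ 6 := by linarith
          exact_mod_cast this
        have hsub : X₁ ⊆ X₁.filter (fun u ↦ inner ℝ u y = (1 : ℝ)) ∪
            X₁.filter (fun u ↦ inner ℝ u (-y) = (1 : ℝ)) := by
          intro u hu
          simp only [mem_union, mem_filter, hu, true_and, inner_neg_right]
          rcases h.inner_eq_one_or hu hy with h | h <;> rw [h] <;> norm_num
        have hc := (card_le_card hsub).trans (card_union_le _ _)
        have ha := hX.card_add_le (filter_subset _ _) (h.self₂ y hy)
          (fun u hu ↦ (mem_filter.mp hu).2) (k := 0) (h := Fin.elim0)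
          ⟨fun i ↦ i.elim0, fun i ↦ i.elim0⟩ (fun _ _ i ↦ i.elim0)
        have hb := hX.card_add_le (filter_subset _ _)
          (show inner ℝ (-y) (-y) = (1 : ℝ) by rw [inner_neg_neg, h.self₂ y hy])
          (fun u hu ↦ (mem_filter.mp hu).2) (k := 0) (h := Fin.elim0)
          ⟨fun i ↦ i.elim0, fun i ↦ i.elim0⟩ (fun _ _ i ↦ i.elim0)
        omega
  · have := h.weight_le_of_nonempty_right h3
    omega

end IsRootProjection

end EuclideanConfigurations

section RootFamily

variable {V : Type*} [NormedAddCommGroup V] [InnerProductSpace ℝ V] {ι : Type*}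

open Module Finset

/-- A family of vectors enumerating a reduced crystallographic root system in a Euclidean space. -/
structure IsRootFamily (v : ι → V) : Prop where
  injective : Function.Injective v
  ne_zero : ∀ i, v i ≠ 0
  exists_int : ∀ i j, ∃ n : ℤ, 2 * inner ℝ (v i) (v j) = n * inner ℝ (v j) (v j)
  exists_reflection : ∀ i j, ∃ k,
    v k = v i - (2 * inner ℝ (v i) (v j) / inner ℝ (v j) (v j)) • v j
  eq_or_eq_neg : ∀ i j, inner ℝ (v i) (v j) ^ 2 = inner ℝ (v i) (v i) * inner ℝ (v j) (v j) →
    v i = v j ∨ v i = -v j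

/-- The square of the cosine of the angle between two vectors. -/
noncomputable def cosSq (x y : V) : ℝ := inner ℝ x y ^ 2 / (inner ℝ x x * inner ℝ y y)

lemma cosSq_smul_smul {a b : ℝ} (ha : a ≠ 0) (hb : b ≠ 0) (x y : V) :
    cosSq (a • x) (b • y) = cosSq x y := by
  simp only [cosSq, inner_smul_left, inner_smul_right, conj_trivial]
  rw [show (b * (a * inner ℝ x y)) ^ 2 = (a ^ 2 * b ^ 2) * inner ℝ x y ^ 2 by ring,
    show a * (a * inner ℝ x x) * (b * (b * inner ℝ y y)) =
      (a ^ 2 * b ^ 2) * (inner ℝ x x * inner ℝ y y) by ring,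
    mul_div_mul_left _ _ (by positivity)]

/-- A trace inequality for the frame operator of a finite family of unit vectors. -/
lemma card_sq_le_finrank_mul_sum_inner_sq [Fintype ι] [FiniteDimensional ℝ V] {u : ι → V}
    (hu : ∀ i, inner ℝ (u i) (u i) = (1 : ℝ)) :
    (Fintype.card ι : ℝ) ^ 2 ≤ finrank ℝ V * ∑ i, ∑ j, inner ℝ (u i) (u j) ^ 2 := by
  set e := stdOrthonormalBasis ℝ V
  set T : Fin (finrank ℝ V) → Fin (finrank ℝ V) → ℝ :=
    fun a b ↦ ∑ i, inner ℝ (u i) (e a) * inner ℝ (u i) (e b) with hT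
  have hin (x y : V) : ∑ a, inner ℝ x (e a) * inner ℝ y (e a) = inner ℝ x y := by
    rw [← e.sum_inner_mul_inner x y]
    exact sum_congr rfl fun a _ ↦ by rw [real_inner_comm y (e a)]
  have h1 : ∑ a, T a a = Fintype.card ι := by
    rw [hT, sum_comm, sum_congr rfl fun i _ ↦ (hin (u i) (u i)).trans (hu i)]
    simp
  have h2 : ∑ a, ∑ b, T a b ^ 2 = ∑ i, ∑ j, inner ℝ (u i) (u j) ^ 2 := by
    calc ∑ a, ∑ b, T a b ^ 2
        = ∑ a, ∑ b, ∑ i, ∑ j, (inner ℝ (u i) (e a) * inner ℝ (u j) (e a)) *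
            (inner ℝ (u i) (e b) * inner ℝ (u j) (e b)) := by
          refine sum_congr rfl fun a _ ↦ sum_congr rfl fun b _ ↦ ?_
          rw [hT, sq, sum_mul_sum]
          exact sum_congr rfl fun i _ ↦ sum_congr rfl fun j _ ↦ by ring
      _ = ∑ a, ∑ i, ∑ j, (inner ℝ (u i) (e a) * inner ℝ (u j) (e a)) *
            ∑ b, (inner ℝ (u i) (e b) * inner ℝ (u j) (e b)) := by
          refine sum_congr rfl fun a _ ↦ ?_
          rw [sum_comm]
          refine sum_congr rfl fun i _ ↦ ?_
          rw [sum_comm]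
          simp_rw [mul_sum]
      _ = ∑ i, ∑ j, inner ℝ (u i) (u j) ^ 2 := by
          rw [sum_comm]
          refine sum_congr rfl fun i _ ↦ ?_
          rw [sum_comm]
          refine sum_congr rfl fun j _ ↦ ?_
          rw [← sum_mul, hin, sq]
  calc (Fintype.card ι : ℝ) ^ 2 = (∑ a, T a a) ^ 2 := by rw [h1]
    _ ≤ finrank ℝ V * ∑ a, T a a ^ 2 := by
        have := sq_sum_le_card_mul_sum_sq (s := univ) (f := fun a ↦ T a a)
        simpa using this
    _ ≤ finrank ℝ V * ∑ a, ∑ b, T a b ^ 2 := by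
        gcongr with a
        exact single_le_sum (f := fun b ↦ T a b ^ 2) (fun b _ ↦ sq_nonneg _) (mem_univ a)
    _ = _ := by rw [h2]

namespace IsRootFamily

variable {v : ι → V}

lemma inner_self_pos (h : IsRootFamily v) (i : ι) : (0 : ℝ) < inner ℝ (v i) (v i) :=
  real_inner_self_pos.mpr (h.ne_zero i)

lemma smul (h : IsRootFamily v) {c : ℝ} (hc : c ≠ 0) : IsRootFamily (fun i ↦ c • v i) where
  injective := (smul_right_injective V hc).comp h.injective
  ne_zero i := smul_ne_zero hc (h.ne_zero i)
  exists_int i j := by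
    obtain ⟨n, hn⟩ := h.exists_int i j
    refine ⟨n, ?_⟩
    simp only [inner_smul_left, inner_smul_right, conj_trivial]
    linear_combination c ^ 2 * hn
  exists_reflection i j := by
    obtain ⟨k, hk⟩ := h.exists_reflection i j
    refine ⟨k, ?_⟩
    have := (h.inner_self_pos j).ne'
    simp only [inner_smul_left, inner_smul_right, conj_trivial]
    rw [hk, smul_sub, smul_smul, smul_smul]
    congr 2
    field_simp
  eq_or_eq_neg i j hij := by
    simp only [inner_smul_left, inner_smul_right, conj_trivial] at hij
    rcases h.eq_or_eq_neg i j (by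
      have : c ^ 4 ≠ 0 := by positivity
      apply mul_left_cancel₀ this
      linear_combination hij) with h | h
    · left; rw [h]
    · right; rw [h, smul_neg]

/-- The family of coroots. -/
lemma dual (h : IsRootFamily v) : IsRootFamily (fun i ↦ (2 / inner ℝ (v i) (v i)) • v i) where
  injective := by
    have key (i : ι) : v i = (2 / inner ℝ ((2 / inner ℝ (v i) (v i)) • v i)
        ((2 / inner ℝ (v i) (v i)) • v i)) • (2 / inner ℝ (v i) (v i)) • v i := by
      have := (h.inner_self_pos i).ne'
      simp only [inner_smul_left, inner_smul_right, conj_trivial, smul_smul]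
      rw [show 2 / (2 / inner ℝ (v i) (v i) * (2 / inner ℝ (v i) (v i) * inner ℝ (v i) (v i))) *
        (2 / inner ℝ (v i) (v i)) = (1 : ℝ) by field_simp, one_smul]
    intro i j hij
    apply h.injective
    simp only at hij
    rw [key i, key j, hij]
  ne_zero i := smul_ne_zero (div_ne_zero two_ne_zero (h.inner_self_pos i).ne') (h.ne_zero i)
  exists_int i j := by
    obtain ⟨n, hn⟩ := h.exists_int j i
    refine ⟨n, ?_⟩
    have := (h.inner_self_pos i).ne'
    have := (h.inner_self_pos j).ne'
    simp only [inner_smul_left, inner_smul_right, conj_trivial]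
    rw [real_inner_comm] at hn
    field_simp
    linear_combination hn
  exists_reflection i j := by
    obtain ⟨k, hk⟩ := h.exists_reflection i j
    refine ⟨k, ?_⟩
    have := (h.inner_self_pos i).ne'
    have := (h.inner_self_pos j).ne'
    have hkk : inner ℝ (v k) (v k) = inner ℝ (v i) (v i) := by
      rw [hk]
      simp only [inner_sub_left, inner_sub_right, inner_smul_left, inner_smul_right, conj_trivial,
        real_inner_comm (v i) (v j)]
      field_simp
      ring
    simp only [inner_smul_left, inner_smul_right, conj_trivial]
    rw [hkk, hk, smul_sub, smul_smul, smul_smul]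
    congr 2
    field_simp
  eq_or_eq_neg i j hij := by
    have := (h.inner_self_pos i).ne'
    have := (h.inner_self_pos j).ne'
    simp only [inner_smul_left, inner_smul_right, conj_trivial] at hij
    rcases h.eq_or_eq_neg i j (by
      field_simp at hij
      linear_combination hij) with h | h
    · left; simp only [h]
    · right; simp only [h, smul_neg, inner_neg_neg]

/-- Two non-orthogonal roots of different lengths have squared length ratio `2` or `3`. -/
lemma ratio (h : IsRootFamily v) {i j : ι} (hij : inner ℝ (v i) (v j) ≠ (0 : ℝ))
    (hlt : inner ℝ (v j) (v j) < inner ℝ (v i) (v i)) :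
    2 * inner ℝ (v j) (v j) ≤ inner ℝ (v i) (v i) ∧
      inner ℝ (v i) (v i) ≤ 3 * inner ℝ (v j) (v j) := by
  obtain ⟨n, hn⟩ := h.exists_int i j
  obtain ⟨m, hm⟩ := h.exists_int j i
  rw [real_inner_comm] at hm
  have hi := h.inner_self_pos i
  have hj := h.inner_self_pos j
  have hprod : 4 * inner ℝ (v i) (v j) ^ 2 =
      ((n * m : ℤ) : ℝ) * (inner ℝ (v i) (v i) * inner ℝ (v j) (v j)) := by
    push_cast
    linear_combination 2 * inner ℝ (v i) (v j) * hn + n * inner ℝ (v j) (v j) * hm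
  have hpos : 0 < n * m := by
    have : (0 : ℝ) < ((n * m : ℤ) : ℝ) := by
      refine pos_of_mul_pos_left (b := inner ℝ (v i) (v i) * inner ℝ (v j) (v j)) ?_ (by positivity)
      rw [← hprod]; positivity
    exact_mod_cast this
  have hcs := inner_sq_le_inner_mul_inner (v i) (v j)
  have hne : inner ℝ (v i) (v j) ^ 2 ≠ inner ℝ (v i) (v i) * inner ℝ (v j) (v j) := by
    intro heq
    rcases h.eq_or_eq_neg i j heq with e | e <;> rw [e] at hlt <;> simp at hlt
  have hlt4 : n * m < 4 := by
    have h1 := lt_of_le_of_ne hcs hne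
    have : ((n * m : ℤ) : ℝ) < 4 := by
      refine lt_of_mul_lt_mul_right (a := inner ℝ (v i) (v i) * inner ℝ (v j) (v j)) ?_
        (by positivity)
      rw [← hprod]; linarith
    exact_mod_cast this
  have hnm : (n : ℝ) * inner ℝ (v j) (v j) = m * inner ℝ (v i) (v i) := by rw [← hn, ← hm]
  have hn0 : n ≠ 0 := by rintro rfl; simp at hpos
  have hm0 : m ≠ 0 := by rintro rfl; simp at hpos
  have hn1 : -3 ≤ n := by
    rcases lt_or_gt_of_ne hm0 with h | h <;> nlinarith
  have hn2 : n ≤ 3 := by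
    rcases lt_or_gt_of_ne hm0 with h | h <;> nlinarith
  have hm1 : -3 ≤ m := by
    rcases lt_or_gt_of_ne hn0 with h | h <;> nlinarith
  have hm2 : m ≤ 3 := by
    rcases lt_or_gt_of_ne hn0 with h | h <;> nlinarith
  clear hn hm hprod hcs hne
  interval_cases n <;> interval_cases m <;>
    first | omega | (push_cast at hnm; constructor <;> linarith)

/-- The roots which are not orthogonal to a fixed root cannot be both longer and shorter. -/
lemma long_or_short (h : IsRootFamily v) (j : ι) :
    (∀ i, inner ℝ (v i) (v j) ≠ (0 : ℝ) → inner ℝ (v i) (v i) ≤ inner ℝ (v j) (v j)) ∨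
    (∀ i, inner ℝ (v i) (v j) ≠ (0 : ℝ) → inner ℝ (v j) (v j) ≤ inner ℝ (v i) (v i)) := by
  by_contra! hcon
  obtain ⟨⟨i, hi, hij⟩, k, hk, hkj⟩ := hcon
  have hj := h.inner_self_pos j
  have hkp := h.inner_self_pos k
  have r1 := (h.ratio hi hij).1
  have r2 := (h.ratio (i := j) (j := k) (by rwa [real_inner_comm]) hkj).1
  have orth (l : ι) (hl : inner ℝ (v l) (v l) = inner ℝ (v k) (v k)) :
      inner ℝ (v i) (v l) = (0 : ℝ) := by
    by_contra hne
    have := (h.ratio hne (by linarith)).2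
    linarith
  obtain ⟨l, hl⟩ := h.exists_reflection k j
  have hll : inner ℝ (v l) (v l) = inner ℝ (v k) (v k) := by
    rw [hl]
    simp only [inner_sub_left, inner_sub_right, inner_smul_left, inner_smul_right, conj_trivial,
      real_inner_comm (v k) (v j)]
    field_simp
    ring
  have h1 := orth l hll
  rw [hl, inner_sub_right, orth k rfl, inner_smul_right, zero_sub, neg_eq_zero, mul_eq_zero,
    div_eq_zero_iff] at h1
  rcases h1 with (h1 | h1) | h1
  · exact hk (by linarith)
  · exact hj.ne' h1
  · exact hi h1

variable [Fintype ι]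

/-- The roots of square length `1 / p` which make an acute angle with the unit vector `b`. -/
noncomputable def acute (v : ι → V) (b : V) (p : ℝ) : Finset ι := by
  classical
  exact univ.filter fun i ↦ 2 * inner ℝ (v i) b = (1 : ℝ) ∧ p * inner ℝ (v i) (v i) = 1

lemma mem_acute {b : V} {p : ℝ} {i : ι} : i ∈ acute v b p ↔
    2 * inner ℝ (v i) b = (1 : ℝ) ∧ p * inner ℝ (v i) (v i) = 1 := by
  simp [acute]

lemma weight_acute_le [FiniteDimensional ℝ V] (h : IsRootFamily v) {b : V}
    (hb : inner ℝ b b = (1 : ℝ)) :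
    #(acute v b 1) + 2 * #(acute v b 2) + 3 * #(acute v b 3) + 4 ≤ 4 * finrank ℝ V + 28 := by
  classical
  set W := (Submodule.span ℝ {b})ᗮ with hW
  have hb0 : b ≠ 0 := by rintro rfl; simp at hb
  have hrank : finrank ℝ W + 1 = finrank ℝ V := by
    have := Submodule.finrank_add_finrank_orthogonal (Submodule.span ℝ {b})
    rw [finrank_span_singleton hb0, ← hW] at this
    omega
  set w : ι → W := fun i ↦ if hi : (2 : ℝ) • v i - b ∈ W then ⟨_, hi⟩ else 0 with hw
  have hwi {i : ι} (hi : 2 * inner ℝ (v i) b = (1 : ℝ)) : (w i : V) = (2 : ℝ) • v i - b := by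
    have : (2 : ℝ) • v i - b ∈ W := by
      rw [hW, Submodule.mem_orthogonal_singleton_iff_inner_left, inner_sub_left, inner_smul_left,
        hb]
      simpa [sub_eq_zero] using hi
    simp only [hw, dif_pos this]
  have hinner {i k : ι} (hi : 2 * inner ℝ (v i) b = (1 : ℝ))
      (hk : 2 * inner ℝ (v k) b = (1 : ℝ)) :
      inner ℝ (w i) (w k) = 4 * inner ℝ (v i) (v k) - (1 : ℝ) := by
    rw [Submodule.coe_inner, hwi hi, hwi hk]
    rw [real_inner_comm] at hk
    simp only [inner_sub_left, inner_sub_right, inner_smul_left, inner_smul_right, conj_trivial,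
      hb]
    linarith
  have hinj {p : ℝ} : Set.InjOn w (acute v b p) := by
    intro i hi k hk hik
    have h1 := congrArg (Subtype.val : W → V) hik
    rw [hwi (mem_acute.mp hi).1, hwi (mem_acute.mp hk).1, sub_left_inj] at h1
    exact h.injective (smul_right_injective V two_ne_zero h1)
  have exists_two_mul {i k : ι} {p q : ℝ} (hi : i ∈ acute v b p) (hk : k ∈ acute v b q) :
      ∃ a : ℤ, q * inner ℝ (w i) (w k) = 2 * a - q := by
    obtain ⟨a, ha⟩ := h.exists_int i k
    rw [mem_acute] at hi hk
    refine ⟨a, ?_⟩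
    rw [hinner hi.1 hk.1]
    linear_combination 2 * q * ha + 2 * a * hk.2
  have hself {i : ι} {p : ℝ} (hi : i ∈ acute v b p) :
      p * inner ℝ (w i) (w i) = 4 - p := by
    rw [mem_acute] at hi
    rw [hinner hi.1 hi.1]
    linear_combination 4 * hi.2
  have hproj : IsRootProjection ((acute v b 1).image w) ((acute v b 2).image w)
      ((acute v b 3).image w) := by
    constructor <;> simp only [forall_mem_image]
    · intro i hi
      linarith [hself hi]
    · intro i hi
      linarith [hself hi]
    · intro i hi
      linarith [hself hi]
    · intro i hi k hk
      obtain ⟨a, ha⟩ := exists_two_mul hi hk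
      exact ⟨a, by linarith⟩
    · intro i hi k hk
      obtain ⟨a, ha⟩ := exists_two_mul hk hi
      exact ⟨a, by rw [real_inner_comm]; linarith⟩
    · intro i hi k hk
      obtain ⟨a, ha⟩ := exists_two_mul hk hi
      exact ⟨a, by rw [real_inner_comm]; linarith⟩
    · intro i hi k hk
      obtain ⟨a, ha⟩ := exists_two_mul hi hk
      exact ⟨a, by linarith⟩
    · intro i hi k hk
      obtain ⟨a, ha⟩ := exists_two_mul hi hk
      obtain ⟨c, hc⟩ := exists_two_mul hk hi
      rw [real_inner_comm] at hc
      have h1 : 2 * (a : ℝ) = 3 * c := by linarith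
      have h1 : 2 * a = 3 * c := by exact_mod_cast h1
      obtain ⟨t, rfl⟩ : ∃ t, c = 2 * t := ⟨a - c, by omega⟩
      refine ⟨t, ?_⟩
      push_cast at hc
      linarith
    · intro i hi k hk
      obtain ⟨a, ha⟩ := exists_two_mul hi hk
      exact ⟨a, by linarith⟩
  have := hproj.weight_le
  rw [card_image_of_injOn hinj, card_image_of_injOn hinj, card_image_of_injOn hinj] at this
  omega

private lemma sum_cosSq_le_of_long_of_inner_self [FiniteDimensional ℝ V] (h : IsRootFamily v)
    {j : ι} (hj : inner ℝ (v j) (v j) = (1 : ℝ))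
    (hlong : ∀ i, inner ℝ (v i) (v j) ≠ (0 : ℝ) →
      inner ℝ (v i) (v i) ≤ (inner ℝ (v j) (v j) : ℝ)) :
    4 * ∑ i, cosSq (v i) (v j) ≤ 8 * finrank ℝ V + 56 := by
  classical
  have hj' : inner ℝ (-v j) (-v j) = (1 : ℝ) := by rw [inner_neg_neg, hj]
  have hind (b : V) (p : ℝ) (i : ι) : (0 : ℝ) ≤ if i ∈ acute v b p then 1 else 0 := by
    split_ifs <;> norm_num
  have hind' (b : V) (i : ι) : (0 : ℝ) ≤ if v i = b then 1 else 0 := by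
    split_ifs <;> norm_num
  have key (i : ι) : 4 * cosSq (v i) (v j) ≤
      (4 * (if v i = v j then 1 else 0) + 4 * (if v i = -v j then 1 else 0)) +
      ((if i ∈ acute v (v j) 1 then 1 else 0) + 2 * (if i ∈ acute v (v j) 2 then 1 else 0) +
        3 * (if i ∈ acute v (v j) 3 then 1 else 0)) +
      ((if i ∈ acute v (-v j) 1 then 1 else 0) + 2 * (if i ∈ acute v (-v j) 2 then 1 else 0) +
        3 * (if i ∈ acute v (-v j) 3 then 1 else 0)) := by
    have p1 := hind (v j) 1 i
    have p2 := hind (v j) 2 i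
    have p3 := hind (v j) 3 i
    have q1 := hind (-v j) 1 i
    have q2 := hind (-v j) 2 i
    have q3 := hind (-v j) 3 i
    have r1 := hind' (v j) i
    have r2 := hind' (-v j) i
    have hi := h.inner_self_pos i
    have hcs := inner_sq_le_inner_mul_inner (v i) (v j)
    rw [hj, mul_one] at hcs
    have hcos : cosSq (v i) (v j) * inner ℝ (v i) (v i) = inner ℝ (v i) (v j) ^ 2 := by
      rw [cosSq, hj, mul_one]; field_simp
    have hcos1 : cosSq (v i) (v j) ≤ 1 := by
      rw [cosSq, hj, mul_one, div_le_one hi]; exact hcs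
    by_cases hz : inner ℝ (v i) (v j) = (0 : ℝ)
    · have : cosSq (v i) (v j) = 0 := by rw [cosSq, hz]; simp
      rw [this]
      linarith
    by_cases hpar : inner ℝ (v i) (v j) ^ 2 = inner ℝ (v i) (v i) * (inner ℝ (v j) (v j) : ℝ)
    · rcases h.eq_or_eq_neg i j hpar with e | e
      · rw [if_pos e]; linarith
      · rw [if_pos e]; linarith
    rw [hj, mul_one] at hpar
    have hle := hlong i hz
    rw [hj] at hle
    obtain ⟨n, hn⟩ := h.exists_int i j
    obtain ⟨m, hm⟩ := h.exists_int j i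
    rw [real_inner_comm, hn] at hm
    rw [hj, mul_one] at hn hm
    have hn4 : (n : ℝ) ^ 2 < 4 := by
      have := lt_of_le_of_ne hcs hpar
      rw [← hn]; nlinarith
    have hnm4 : ((n * m : ℤ) : ℝ) < 4 := by
      refine lt_of_mul_lt_mul_right (a := inner ℝ (v i) (v i)) ?_ hi.le
      push_cast
      have := lt_of_le_of_ne hcs hpar
      rw [mul_assoc, ← hm, ← hn]; linarith
    have hnm4 : n * m < 4 := by exact_mod_cast hnm4
    have hn4 : n ^ 2 < 4 := by exact_mod_cast hn4
    have hn1 : n ≤ 1 := by nlinarith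
    have hn2 : -1 ≤ n := by nlinarith
    have hn0 : n ≠ 0 := by
      rintro rfl
      simp at hn
      exact hz hn
    have hcases : n = 1 ∨ n = -1 := by omega
    rcases hcases with rfl | rfl
    · have hm1 : 0 < m := by
        have : (0 : ℝ) < m := pos_of_mul_pos_left (by rw [← hm]; norm_num) hi.le
        exact_mod_cast this
      have hcosm : 4 * cosSq (v i) (v j) = m := by
        apply mul_right_cancel₀ hi.ne'
        rw [← hm, mul_assoc, hcos]
        push_cast at hn ⊢
        nlinarith
      have hmem : i ∈ acute v (v j) m := mem_acute.mpr ⟨by simpa using hn, by simpa using hm.symm⟩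
      have hm3 : m ≤ 3 := by omega
      rw [hcosm]
      interval_cases m
      · push_cast at hmem ⊢
        rw [if_pos hmem]; linarith
      · push_cast at hmem ⊢
        rw [if_pos hmem]; linarith
      · push_cast at hmem ⊢
        rw [if_pos hmem]; linarith
    · obtain ⟨m, rfl⟩ : ∃ k, m = -k := ⟨-m, (neg_neg m).symm⟩
      push_cast at hm
      have hm1 : 0 < m := by
        have : (0 : ℝ) < m := pos_of_mul_pos_left (b := inner ℝ (v i) (v i)) (by linarith) hi.le
        exact_mod_cast this
      have hcosm : 4 * cosSq (v i) (v j) = m := by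
        apply mul_right_cancel₀ hi.ne'
        rw [mul_assoc, hcos]
        push_cast at hn ⊢
        nlinarith
      have hmem : i ∈ acute v (-v j) m := mem_acute.mpr
        ⟨by rw [inner_neg_right, mul_neg, hn]; simp, by linarith⟩
      have hm3 : m ≤ 3 := by omega
      rw [hcosm]
      interval_cases m
      · push_cast at hmem ⊢
        rw [if_pos hmem]; linarith
      · push_cast at hmem ⊢
        rw [if_pos hmem]; linarith
      · push_cast at hmem ⊢
        rw [if_pos hmem]; linarith
  have hsum := sum_le_sum fun i (_ : i ∈ univ) ↦ key i
  have hcard (s : Finset ι) : ∑ i, (if i ∈ s then (1 : ℝ) else 0) = #s := by simp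
  have hcard' (b : V) : ∑ i, (if v i = b then (1 : ℝ) else 0) ≤ 1 := by
    rw [sum_boole]
    have : #(univ.filter fun i ↦ v i = b) ≤ 1 := card_le_one.mpr fun i hi k hk ↦
      h.injective ((mem_filter.mp hi).2.trans (mem_filter.mp hk).2.symm)
    exact_mod_cast this
  simp only [sum_add_distrib, ← mul_sum, hcard] at hsum
  have h1 : (_ : ℝ) ≤ _ := Nat.cast_le.mpr (h.weight_acute_le hj)
  have h2 : (_ : ℝ) ≤ _ := Nat.cast_le.mpr (h.weight_acute_le hj')
  push_cast at h1 h2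
  have h3 := hcard' (v j)
  have h4 := hcard' (-v j)
  linarith

private lemma sum_cosSq_le_of_long [FiniteDimensional ℝ V] (h : IsRootFamily v) {j : ι}
    (hlong : ∀ i, inner ℝ (v i) (v j) ≠ (0 : ℝ) →
      inner ℝ (v i) (v i) ≤ (inner ℝ (v j) (v j) : ℝ)) :
    4 * ∑ i, cosSq (v i) (v j) ≤ 8 * finrank ℝ V + 56 := by
  have hc : ‖v j‖⁻¹ ≠ 0 := inv_ne_zero (norm_ne_zero_iff.mpr (h.ne_zero j))
  have := (h.smul hc).sum_cosSq_le_of_long_of_inner_self (j := j) (by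
    rw [inner_smul_left, inner_smul_right, real_inner_self_eq_norm_sq, conj_trivial]
    have := norm_ne_zero_iff.mpr (h.ne_zero j)
    field_simp) (by
    intro i hi
    simp only [inner_smul_left, inner_smul_right, conj_trivial] at hi ⊢
    have := hlong i (fun h0 ↦ hi (by rw [h0]; simp))
    gcongr)
  simpa only [cosSq_smul_smul hc hc] using this

lemma sum_cosSq_le [FiniteDimensional ℝ V] (h : IsRootFamily v) (j : ι) :
    4 * ∑ i, cosSq (v i) (v j) ≤ 8 * finrank ℝ V + 56 := by
  rcases h.long_or_short j with hl | hs
  · exact h.sum_cosSq_le_of_long hl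
  · have hc (i : ι) : 2 / inner ℝ (v i) (v i) ≠ (0 : ℝ) :=
      div_ne_zero two_ne_zero (h.inner_self_pos i).ne'
    have := h.dual.sum_cosSq_le_of_long (j := j) (by
      intro i hi
      have hp := h.inner_self_pos i
      have hq := h.inner_self_pos j
      simp only [inner_smul_left, inner_smul_right, conj_trivial] at hi ⊢
      have := hs i (fun h0 ↦ hi (by rw [h0]; simp))
      field_simp
      linarith)
    simpa only [cosSq_smul_smul (hc _) (hc _)] using this

theorem card_le [FiniteDimensional ℝ V] (h : IsRootFamily v) :
    Fintype.card ι ≤ 2 * finrank ℝ V ^ 2 + 14 * finrank ℝ V := by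
  rcases isEmpty_or_nonempty ι with hι | hι
  · simp
  have hn (i : ι) : ‖v i‖⁻¹ ≠ 0 := inv_ne_zero (norm_ne_zero_iff.mpr (h.ne_zero i))
  have hu (i : ι) : inner ℝ (‖v i‖⁻¹ • v i) (‖v i‖⁻¹ • v i) = (1 : ℝ) := by
    rw [inner_smul_left, inner_smul_right, real_inner_self_eq_norm_sq, conj_trivial]
    have := norm_ne_zero_iff.mpr (h.ne_zero i)
    field_simp
  have hcos (i j : ι) : inner ℝ (‖v i‖⁻¹ • v i) (‖v j‖⁻¹ • v j) ^ 2 = cosSq (v i) (v j) := by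
    rw [← cosSq_smul_smul (hn i) (hn j), cosSq, hu, hu]; simp
  have h1 := card_sq_le_finrank_mul_sum_inner_sq hu
  simp only [hcos] at h1
  rw [sum_comm] at h1
  have h2 : ∑ j, ∑ i, cosSq (v i) (v j) ≤ Fintype.card ι * (2 * finrank ℝ V + 14) := by
    calc ∑ j, ∑ i, cosSq (v i) (v j) ≤ ∑ j : ι, (2 * (finrank ℝ V : ℝ) + 14) :=
          sum_le_sum fun j _ ↦ by linarith [h.sum_cosSq_le j]
      _ = _ := by rw [sum_const, card_univ, nsmul_eq_mul]
  have h3 : (Fintype.card ι : ℝ) * Fintype.card ι ≤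
      Fintype.card ι * (2 * finrank ℝ V ^ 2 + 14 * finrank ℝ V) := by
    have := mul_le_mul_of_nonneg_left h2 (Nat.cast_nonneg (α := ℝ) (finrank ℝ V))
    nlinarith
  have h4 := le_of_mul_le_mul_left h3 (Nat.cast_pos.mpr Fintype.card_pos)
  exact_mod_cast h4

end IsRootFamily

end RootFamily

section RootPairing

open Module Finset

/-- A root family, viewed inside the span of its vectors, bounds its own cardinality. -/
lemma IsRootFamily.card_le_finrank_span {V ι : Type*} [NormedAddCommGroup V]
    [InnerProductSpace ℝ V] [Fintype ι] {v : ι → V} (h : IsRootFamily v) :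
    Fintype.card ι ≤ 2 * finrank ℝ (Submodule.span ℝ (Set.range v)) ^ 2 +
      14 * finrank ℝ (Submodule.span ℝ (Set.range v)) := by
  have : FiniteDimensional ℝ (Submodule.span ℝ (Set.range v)) :=
    FiniteDimensional.span_of_finite ℝ (Set.finite_range v)
  let w (i : ι) : Submodule.span ℝ (Set.range v) :=
    ⟨v i, Submodule.subset_span (Set.mem_range_self i)⟩
  refine IsRootFamily.card_le (v := w) ⟨fun i j hij ↦ h.injective (congrArg Subtype.val hij),
    fun i hi ↦ h.ne_zero i (congrArg Subtype.val hi), h.exists_int, fun i j ↦ ?_, fun i j hij ↦ ?_⟩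
  · exact (h.exists_reflection i j).imp fun k hk ↦ Subtype.ext hk
  · exact (h.eq_or_eq_neg i j hij).imp Subtype.ext Subtype.ext

namespace RootPairing

variable {ι K M N : Type*} [Fintype ι] [Field K] [CharZero K] [AddCommGroup M] [Module K M]
  [AddCommGroup N] [Module K N] (P : RootPairing ι K M N) [P.IsCrystallographic]

/-- The Euclidean vector whose coordinates are the integers obtained by pairing a root with all
the coroots. -/
noncomputable def euclideanRoot (i : ι) : EuclideanSpace ℝ ι :=
  WithLp.toLp 2 fun k ↦ (P.pairingIn ℤ i k : ℝ)

omit [CharZero K] in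
lemma inner_euclideanRoot (i j : ι) : inner ℝ (P.euclideanRoot i) (P.euclideanRoot j) =
    ((∑ k, P.pairingIn ℤ i k * P.pairingIn ℤ j k : ℤ) : ℝ) := by
  simp [euclideanRoot, PiLp.inner_apply, mul_comm]

lemma two_mul_inner_euclideanRoot (i j : ι) :
    2 * inner ℝ (P.euclideanRoot i) (P.euclideanRoot j) =
      P.pairingIn ℤ i j * inner ℝ (P.euclideanRoot j) (P.euclideanRoot j) := by
  have key (i j : ι) : P.RootForm (P.root i) (P.root j) =
      ((∑ k, P.pairingIn ℤ i k * P.pairingIn ℤ j k : ℤ) : K) := by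
    have h (i j : ι) : ((P.pairingIn ℤ i j : ℤ) : K) = P.pairing i j := by
      simpa using P.algebraMap_pairingIn ℤ i j
    simp [rootForm_apply_apply, h]
  have h := (P.posRootForm ℤ).two_mul_apply_root_root i j
  change 2 * P.RootForm _ _ = _ * P.RootForm _ _ at h
  rw [key, key, ← P.algebraMap_pairingIn ℤ, eq_intCast] at h
  rw [inner_euclideanRoot, inner_euclideanRoot]
  exact_mod_cast h

omit [Fintype ι] in
lemma euclideanRoot_of_root_eq {i j k : ι} {x y : ℤ}
    (h : P.root k = x • P.root i + y • P.root j) :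
    P.euclideanRoot k = (x : ℝ) • P.euclideanRoot i + (y : ℝ) • P.euclideanRoot j := by
  ext l
  simp [euclideanRoot, pairingIn_eq_add_of_root_eq_smul_add_smul (S := ℤ) (j := l) h]

lemma isRootFamily_euclideanRoot [P.IsReduced] : IsRootFamily P.euclideanRoot := by
  have hne (i : ι) : P.euclideanRoot i ≠ 0 := fun h ↦ by
    have := congrArg (fun w : EuclideanSpace ℝ ι ↦ w i) h
    simp [euclideanRoot] at this
  refine ⟨fun i j h ↦ ?_, hne, fun i j ↦ ⟨_, P.two_mul_inner_euclideanRoot i j⟩,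
    fun i j ↦ ⟨P.reflectionPerm j i, ?_⟩, fun i j h ↦ ?_⟩
  · have h (k : ι) : P.pairingIn ℤ i k = P.pairingIn ℤ j k := by
      simpa [euclideanRoot] using congrArg (fun w : EuclideanSpace ℝ ι ↦ w k) h
    exact (P.pairingIn_two_two_iff ℤ i j).1 ⟨by simp [h j], by simp [← h i]⟩
  · have hj : inner ℝ (P.euclideanRoot j) (P.euclideanRoot j) ≠ (0 : ℝ) := by simpa using hne j
    rw [two_mul_inner_euclideanRoot, mul_div_cancel_right₀ _ hj,
      P.euclideanRoot_of_root_eq (i := i) (j := j) (x := 1) (y := -P.pairingIn ℤ i j) (by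
        rw [root_reflectionPerm, reflection_apply_root' ℤ]
        module)]
    push_cast
    module
  · by_contra! hcon
    have hi : inner ℝ (P.euclideanRoot i) (P.euclideanRoot i) ≠ (0 : ℝ) := by simpa using hne i
    have hj : inner ℝ (P.euclideanRoot j) (P.euclideanRoot j) ≠ (0 : ℝ) := by simpa using hne j
    refine P.coxeterWeightIn_ne_four ℤ (i := i) (j := j) (fun h ↦ hcon.1 (h ▸ rfl))
      (fun h ↦ hcon.2 ?_) ?_
    · rw [P.euclideanRoot_of_root_eq (i := i) (j := j) (x := 0) (y := -1) (by simpa using h)]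
      simp
    · have h1 := P.two_mul_inner_euclideanRoot i j
      have h2 := P.two_mul_inner_euclideanRoot j i
      rw [real_inner_comm] at h2
      have h3 : (P.pairingIn ℤ i j * P.pairingIn ℤ j i : ℝ) = 4 := by
        refine mul_right_cancel₀ (mul_ne_zero hi hj) ?_
        linear_combination -(2 * inner ℝ (P.euclideanRoot i) (P.euclideanRoot j)) * h1 -
          P.pairingIn ℤ i j * inner ℝ (P.euclideanRoot j) (P.euclideanRoot j) * h2 + 4 * h
      exact_mod_cast h3

lemma finrank_span_euclideanRoot_le [P.IsReduced] [P.IsRootSystem] :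
    finrank ℝ (Submodule.span ℝ (Set.range P.euclideanRoot)) ≤ finrank K M := by
  classical
  obtain ⟨b⟩ := P.nonempty_base
  rw [finrank_eq_card_basis b.toWeightBasis, Fintype.card_coe]
  have hle : Submodule.span ℝ (Set.range P.euclideanRoot) ≤
      Submodule.span ℝ (b.support.image P.euclideanRoot : Set (EuclideanSpace ℝ ι)) := by
    refine Submodule.span_le.2 ?_
    rintro _ ⟨i, rfl⟩
    obtain ⟨f, -, -, hf⟩ := b.exists_root_eq_sum_int i
    have : P.euclideanRoot i = ∑ j ∈ b.support, (f j : ℝ) • P.euclideanRoot j := by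
      ext l
      have h : (P.pairingIn ℤ i l : K) = ((∑ j ∈ b.support, f j * P.pairingIn ℤ j l : ℤ) : K) := by
        have h (i j : ι) : ((P.pairingIn ℤ i j : ℤ) : K) = P.coroot' j (P.root i) := by
          simpa using P.algebraMap_pairingIn ℤ i j
        rw [h, hf, map_sum]
        simp only [map_zsmul, ← h]
        simp
      have h : P.pairingIn ℤ i l = ∑ j ∈ b.support, f j * P.pairingIn ℤ j l := by
        exact_mod_cast h
      simp [euclideanRoot, h]
    rw [this]
    exact Submodule.sum_mem _ fun j hj ↦ Submodule.smul_mem _ _ <|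
      Submodule.subset_span (by simpa using ⟨j, hj, rfl⟩)
  exact (Submodule.finrank_mono hle).trans <|
    (finrank_span_finset_le_card _).trans card_image_le

/-- A reduced crystallographic root system of rank `r` has at most `2 r ^ 2 + 14 r` roots. -/
theorem card_le_finrank [P.IsReduced] [P.IsRootSystem] :
    Fintype.card ι ≤ 2 * finrank K M ^ 2 + 14 * finrank K M := by
  refine P.isRootFamily_euclideanRoot.card_le_finrank_span.trans ?_
  gcongr <;> exact P.finrank_span_euclideanRoot_le

end RootPairing

end RootPairing

section LieAlgebras

open Module TensorProduct LieAlgebra LieModule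
open scoped Finset

namespace LieAlgebra

section BaseChange

variable (K A L : Type*) [Field K] [Field A] [Algebra K A] [LieRing L] [LieAlgebra K L]
  [FiniteDimensional K L]

lemma isKilling_baseChange [IsKilling K L] : IsKilling A (A ⊗[K] L) := by
  classical
  let b := finBasis K L
  have hM : LinearMap.BilinForm.toMatrix (b.baseChange A) (killingForm A (A ⊗[K] L)) =
      (algebraMap K A).mapMatrix (LinearMap.BilinForm.toMatrix b (killingForm K L)) := by
    ext i j
    rw [killingForm, traceForm_baseChange]
    simp [LinearMap.BilinForm.toMatrix_apply, LinearMap.BilinForm.baseChange_tmul,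
      Algebra.algebraMap_eq_smul_one]
  have hnd : (killingForm A (A ⊗[K] L)).Nondegenerate := by
    rw [LinearMap.BilinForm.nondegenerate_iff_det_ne_zero (b.baseChange A), hM,
      ← RingHom.map_det, map_ne_zero]
    exact (LinearMap.BilinForm.nondegenerate_iff_det_ne_zero b).1
      (IsKilling.killingForm_nondegenerate K L)
  refine ⟨LieSubmodule.toSubmodule_injective ?_⟩
  exact (LieIdeal.coe_killingCompl_top A (A ⊗[K] L)).trans
    (LinearMap.separatingLeft_iff_ker_eq_bot.1 hnd.1)

variable {K L}

lemma finrank_engel_one_tmul (x : L) :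
    finrank A (LieSubalgebra.engel A ((1 : A) ⊗ₜ[K] x)) =
      finrank K (LieSubalgebra.engel K x) := by
  have h : ad A (A ⊗[K] L) (1 ⊗ₜ x) = (ad K L x).baseChange A := toEnd_baseChange ..
  rw [finrank_engel, finrank_engel, h, LinearMap.charpoly_baseChange]
  simp [Polynomial.natTrailingDegree, Polynomial.trailingDegree,
    Polynomial.support_map_of_injective _ (algebraMap K A).injective]

lemma engel_one_tmul (x : L) :
    (LieSubalgebra.engel A ((1 : A) ⊗ₜ[K] x)).toSubmodule =
      (LieSubalgebra.engel K x).toSubmodule.baseChange A := by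
  have h : ad A (A ⊗[K] L) (1 ⊗ₜ x) = (ad K L x).baseChange A := toEnd_baseChange ..
  symm
  refine Submodule.eq_of_le_of_finrank_eq ?_ ?_
  · rw [Submodule.baseChange_eq_span, Submodule.span_le]
    rintro _ ⟨y, hy, rfl⟩
    obtain ⟨k, hk⟩ := (LieSubalgebra.mem_engel_iff K x y).1 hy
    refine (LieSubalgebra.mem_engel_iff A _ _).2 ⟨k, ?_⟩
    rw [h, ← LinearMap.baseChange_pow]
    simp [hk]
  · refine (Submodule.toBaseChange.toLinearEquiv A _).finrank_eq.symm.trans ?_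
    exact finrank_baseChange.trans (finrank_engel_one_tmul A x).symm

lemma isLieAbelian_engel_one_tmul {x : L} (hx : IsLieAbelian (LieSubalgebra.engel K x)) :
    IsLieAbelian (LieSubalgebra.engel A ((1 : A) ⊗ₜ[K] x)) := by
  refine ⟨fun ⟨y, hy⟩ ⟨z, hz⟩ ↦ Subtype.ext ?_⟩
  change ⁅y, z⁆ = 0
  replace hy : y ∈ (LieSubalgebra.engel A ((1 : A) ⊗ₜ[K] x)).toSubmodule := hy
  replace hz : z ∈ (LieSubalgebra.engel A ((1 : A) ⊗ₜ[K] x)).toSubmodule := hz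
  rw [engel_one_tmul, Submodule.baseChange_eq_span] at hy hz
  refine Submodule.span_induction₂ (p := fun y z _ _ ↦ ⁅y, z⁆ = 0) ?_ (by simp) (by simp)
    ?_ ?_ ?_ ?_ hy hz
  · rintro _ _ ⟨y, hy, rfl⟩ ⟨z, hz, rfl⟩
    have : ⁅y, z⁆ = 0 := congrArg Subtype.val (hx.trivial ⟨y, hy⟩ ⟨z, hz⟩)
    simp [this]
  all_goals intros; simp [*]

end BaseChange

section Dimension

variable {K L : Type*} [Field K] [CharZero K] [LieRing L] [LieAlgebra K L]
  [FiniteDimensional K L] [IsKilling K L] (H : LieSubalgebra K L) [H.IsCartanSubalgebra]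
  [IsTriangularizable K H L]

lemma finrank_le_finrank_add_card_root : finrank K L ≤ finrank K H + #H.root := by
  classical
  have hds := DirectSum.isInternal_submodule_of_iSupIndep_of_iSup_eq_top
    (LieSubmodule.iSupIndep_toSubmodule.mpr <| iSupIndep_genWeightSpace' K H L)
    (LieSubmodule.iSup_toSubmodule_eq_top.mpr <| iSup_genWeightSpace_eq_top' K H L)
  have hsum := (LinearEquiv.ofBijective (DirectSum.coeLinearMap _) hds).finrank_eq
  rw [finrank_directSum, ← Finset.sum_filter_add_sum_filter_not _ Weight.IsZero] at hsum
  have h0 : ∑ α : Weight K H L with α.IsZero, finrank K (genWeightSpace L α) ≤ finrank K H := by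
    refine (Finset.sum_le_card_nsmul _ _ (finrank K H) fun α hα ↦ ?_).trans ?_
    · have hα : (α : H → K) = 0 := by simpa using hα
      rw [hα]
      exact (congrArg (fun N : LieSubmodule K H L ↦ finrank K N) (rootSpace_zero_eq K L H)).le
    · have : #{α : Weight K H L | α.IsZero} ≤ 1 := Finset.card_le_one.2 fun α hα β hβ ↦
        DFunLike.coe_injective <|
          (Finset.mem_filter.1 hα).2.eq.trans (Finset.mem_filter.1 hβ).2.eq.symm
      simpa using Nat.mul_le_mul_right (finrank K H) this
  have h1 : ∑ α : Weight K H L with ¬ α.IsZero, finrank K (genWeightSpace L α) = #H.root := by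
    rw [Finset.card_eq_sum_ones]
    refine Finset.sum_congr (by ext; simp) fun α hα ↦ ?_
    exact IsKilling.finrank_rootSpace_eq_one α (by simpa using hα)
  rw [← hsum, ← h1]
  exact Nat.add_le_add_right h0 _

lemma IsKilling.finrank_le :
    finrank K L ≤ 2 * finrank K H ^ 2 + 15 * finrank K H := by
  have h := (IsKilling.rootSystem H).card_le_finrank
  rw [Fintype.card_coe, Subspace.dual_finrank_eq] at h
  linarith [finrank_le_finrank_add_card_root H]

end Dimension

end LieAlgebra

end LieAlgebras

/-- If `𝔤` is a finite-dimensional semisimple real Lie algebra in which every abelian Lie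
subalgebra has dimension at most `n`, then `dim 𝔤 ≤ 2n² + 15n`. -/
theorem dim_le_of_semisimple_real_lie_algebra
    (L : Type*) [LieRing L] [LieAlgebra ℝ L]
    [FiniteDimensional ℝ L] [LieAlgebra.IsSemisimple ℝ L] (n : ℕ)
    (hA : ∀ H : LieSubalgebra ℝ L, IsLieAbelian H → Module.finrank ℝ H ≤ n) :
    Module.finrank ℝ L ≤ 2 * n ^ 2 + 15 * n := by
  obtain ⟨x, hx⟩ := LieAlgebra.exists_isCartanSubalgebra_engel (K := ℝ) (L := L)
  have hab : IsLieAbelian (LieSubalgebra.engel ℝ x) := inferInstance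
  have hn := hA _ hab
  have := LieAlgebra.isKilling_baseChange ℝ ℂ L
  have habC := LieAlgebra.isLieAbelian_engel_one_tmul ℂ hab
  have : (LieSubalgebra.engel ℂ ((1 : ℂ) ⊗ₜ[ℝ] x)).IsCartanSubalgebra :=
    ⟨inferInstance, LieSubalgebra.normalizer_engel ℂ _⟩
  have h := LieAlgebra.IsKilling.finrank_le (LieSubalgebra.engel ℂ ((1 : ℂ) ⊗ₜ[ℝ] x))
  rw [Module.finrank_baseChange, LieAlgebra.finrank_engel_one_tmul] at h
  refine h.trans ?_
  gcongr
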